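/- arXiv:1904.07049 — 2 statements merged into one kernel-verified Lean document; each statement's English description precedes it below -/
import Mathlib

section
/- Let x ∈ V solve b_K(x,φ) = −α^{−1/2}⟨u_d, Iφ₁⟩_W for all φ ∈ V, let x_h ∈ V_h solve b_K(x_h,φ_h) = −α^{−1/2}⟨u_d, Iφ_{h,1}⟩_W for all φ_h ∈ V_h, and let R_h x be the generalized Ritz projection of x. Then d_{K,α}(x_h, R_h x) ≤ κ_h·μ_h·(M/√α)·|x − R_h x|, where κ_h = ((1+2L)/(1+L))·(1 + M(1 + 2M/√α)·μ_h) with L = M/√α. -/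
open scoped RealInnerProductSpace
open Filter Topology

noncomputable section Setup

variable {V₁ V₂ Q W : Type*}
  [NormedAddCommGroup V₁] [InnerProductSpace ℝ V₁]
  [NormedAddCommGroup V₂] [InnerProductSpace ℝ V₂]
  [NormedAddCommGroup Q] [InnerProductSpace ℝ Q]
  [NormedAddCommGroup W] [InnerProductSpace ℝ W]

/-- The ℓ²-norm on the product space `V = V₁ × V₂`. -/
def nV (v : V₁ × V₂) : ℝ := Real.sqrt (‖v.1‖ ^ 2 + ‖v.2‖ ^ 2)

/-- The seminorm `|v| = (‖I v₁‖² + ‖C* v₂‖²)^{1/2}`. -/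
def sV (Cs : V₂ →L[ℝ] Q) (Iop : V₁ →L[ℝ] W) (v : V₁ × V₂) : ℝ :=
  Real.sqrt (‖Iop v.1‖ ^ 2 + ‖Cs v.2‖ ^ 2)

/-- The vectorized bilinear form `a(v,φ) = a(v₁,φ₂) + a(φ₁,v₂)` on `V × V`. -/
def aV (a : V₁ →L[ℝ] V₂ →L[ℝ] ℝ) (v φ : V₁ × V₂) : ℝ := a v.1 φ.2 + a φ.1 v.2

/-- The bilinear form `b = a + α^{-1/2} c` of the rescaled reduced optimality system. -/
def bV (a : V₁ →L[ℝ] V₂ →L[ℝ] ℝ) (Cs : V₂ →L[ℝ] Q) (Iop : V₁ →L[ℝ] W) (α : ℝ)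
    (v φ : V₁ × V₂) : ℝ :=
  aV a v φ + (Real.sqrt α)⁻¹ * (⟪Cs v.2, Cs φ.2⟫ - ⟪Iop v.1, Iop φ.1⟫)

/-- Continuity constant `M_a = sup { a(v₁,v₂) : ‖v₁‖ = 1, ‖v₂‖ = 1 }`. -/
def contConst (a : V₁ →L[ℝ] V₂ →L[ℝ] ℝ) : ℝ :=
  sSup {r : ℝ | ∃ v₁ : V₁, ∃ v₂ : V₂, ‖v₁‖ = 1 ∧ ‖v₂‖ = 1 ∧ r = a v₁ v₂}

/-- Inf-sup constant `m_a = inf_{‖v₂‖=1} sup_{‖v₁‖=1} a(v₁,v₂)`. -/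
def infSupConst (a : V₁ →L[ℝ] V₂ →L[ℝ] ℝ) : ℝ :=
  sInf {r : ℝ | ∃ v₂ : V₂, ‖v₂‖ = 1 ∧
    r = sSup {s : ℝ | ∃ v₁ : V₁, ‖v₁‖ = 1 ∧ s = a v₁ v₂}}

/-- Discrete inf-sup constant of `a` on `V_{h,1} × V_{h,2}`. -/
def discInfSup (a : V₁ →L[ℝ] V₂ →L[ℝ] ℝ) (Vh1 : Submodule ℝ V₁)
    (Vh2 : Submodule ℝ V₂) : ℝ :=
  sInf {r : ℝ | ∃ v₁ ∈ Vh1, ‖v₁‖ = 1 ∧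
    r = sSup {s : ℝ | ∃ φ₂ ∈ Vh2, ‖φ₂‖ = 1 ∧ s = a v₁ φ₂}}

/-- Best approximation error `inf_{v_h ∈ V_h} ‖x - v_h‖` in the product norm. -/
def bestErr (Vh1 : Submodule ℝ V₁) (Vh2 : Submodule ℝ V₂) (x : V₁ × V₂) : ℝ :=
  sInf {r : ℝ | ∃ vh : V₁ × V₂, vh.1 ∈ Vh1 ∧ vh.2 ∈ Vh2 ∧ r = nV (x - vh)}

/-- The quasi-best-approximation constant `ν_h` of the Galerkin discretization of `b`:
`sup` over nonzero discrete test functions of the ratio of the continuous sup to the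
discrete sup. -/
def nuConst (a : V₁ →L[ℝ] V₂ →L[ℝ] ℝ) (Cs : V₂ →L[ℝ] Q) (Iop : V₁ →L[ℝ] W) (α : ℝ)
    (Vh1 : Submodule ℝ V₁) (Vh2 : Submodule ℝ V₂) : ℝ :=
  sSup {r : ℝ | ∃ φh : V₁ × V₂, φh.1 ∈ Vh1 ∧ φh.2 ∈ Vh2 ∧ φh ≠ 0 ∧
    r = sSup {s : ℝ | ∃ v : V₁ × V₂, nV v = 1 ∧ s = bV a Cs Iop α v φh} /
        sSup {s : ℝ | ∃ vh : V₁ × V₂, vh.1 ∈ Vh1 ∧ vh.2 ∈ Vh2 ∧ nV vh = 1 ∧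
          s = bV a Cs Iop α vh φh}}

/-- The nonlinear form `c_{K,α}` associated with the control constraint set `K`
(through its metric projection `PK`). -/
def cK (Cs : V₂ →L[ℝ] Q) (Iop : V₁ →L[ℝ] W) (PK : Q → Q) (α : ℝ) (v φ : V₁ × V₂) : ℝ :=
  -⟪PK ((-(Real.sqrt α)⁻¹) • (Cs v.2)), Cs φ.2⟫ - (Real.sqrt α)⁻¹ * ⟪Iop v.1, Iop φ.1⟫

/-- The nonlinear form `b_K = a + c_{K,α}`. -/
def bK (a : V₁ →L[ℝ] V₂ →L[ℝ] ℝ) (Cs : V₂ →L[ℝ] Q) (Iop : V₁ →L[ℝ] W) (PK : Q → Q)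
    (α : ℝ) (v φ : V₁ × V₂) : ℝ :=
  aV a v φ + cK Cs Iop PK α v φ

/-- The pseudometric `δ_{K,α}`. -/
def deltaK (Cs : V₂ →L[ℝ] Q) (Iop : V₁ →L[ℝ] W) (PK : Q → Q) (α : ℝ)
    (v w : V₁ × V₂) : ℝ :=
  Real.sqrt (α * ‖PK ((-(Real.sqrt α)⁻¹) • (Cs v.2)) -
      PK ((-(Real.sqrt α)⁻¹) • (Cs w.2))‖ ^ 2 + ‖Iop (v.1 - w.1)‖ ^ 2)

end Setup

section MetricProjection

variable {Q : Type*} [NormedAddCommGroup Q] [InnerProductSpace ℝ Q] {K : Set Q} {PK : Q → Q}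

lemma inner_sub_proj_le_zero (hK : Convex ℝ K) (hmem : ∀ q, PK q ∈ K)
    (hmin : ∀ q : Q, ∀ p ∈ K, ‖q - PK q‖ ≤ ‖q - p‖) (q : Q) {p : Q} (hp : p ∈ K) :
    ⟪q - PK q, p - PK q⟫ ≤ 0 := by
  refine (norm_eq_iInf_iff_real_inner_le_zero hK (hmem q)).1 ?_ p hp
  have : Nonempty K := ⟨⟨PK q, hmem q⟩⟩
  refine le_antisymm (le_ciInf fun w => hmin q w w.2) ?_
  exact ciInf_le (f := fun w : K => ‖q - w‖) ⟨0, by rintro _ ⟨w, rfl⟩; exact norm_nonneg _⟩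
    ⟨PK q, hmem q⟩

lemma norm_proj_sub_proj_sq_le_inner (hK : Convex ℝ K) (hmem : ∀ q, PK q ∈ K)
    (hmin : ∀ q : Q, ∀ p ∈ K, ‖q - PK q‖ ≤ ‖q - p‖) (q r : Q) :
    ‖PK q - PK r‖ ^ 2 ≤ ⟪PK q - PK r, q - r⟫ := by
  have h₁ := inner_sub_proj_le_zero hK hmem hmin q (hmem r)
  have h₂ := inner_sub_proj_le_zero hK hmem hmin r (hmem q)
  rw [← real_inner_self_eq_norm_sq]
  simp only [inner_sub_left, inner_sub_right] at *
  linarith [real_inner_comm q (PK q), real_inner_comm q (PK r), real_inner_comm r (PK q),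
    real_inner_comm r (PK r), real_inner_comm (PK q) (PK r)]

lemma norm_proj_sub_proj_le (hK : Convex ℝ K) (hmem : ∀ q, PK q ∈ K)
    (hmin : ∀ q : Q, ∀ p ∈ K, ‖q - PK q‖ ≤ ‖q - p‖) (q r : Q) :
    ‖PK q - PK r‖ ≤ ‖q - r‖ := by
  have h := (norm_proj_sub_proj_sq_le_inner hK hmem hmin q r).trans (real_inner_le_norm _ _)
  rw [sq] at h
  rcases (norm_nonneg (PK q - PK r)).eq_or_lt with h₀ | h₀
  · rw [← h₀]; exact norm_nonneg _
  · exact le_of_mul_le_mul_left h h₀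

end MetricProjection

section DiscreteInfSup

variable {V₁ V₂ : Type*} [NormedAddCommGroup V₁] [InnerProductSpace ℝ V₁]
  [NormedAddCommGroup V₂] [InnerProductSpace ℝ V₂] (a : V₁ →L[ℝ] V₂ →L[ℝ] ℝ)
  {Vh1 : Submodule ℝ V₁} {Vh2 : Submodule ℝ V₂}

lemma apply_le_of_norm_eq_sSup
    (hadj : ∀ v₂ : V₂, ‖v₂‖ = sSup {r : ℝ | ∃ φ₁ : V₁, ‖φ₁‖ = 1 ∧ r = a φ₁ v₂})
    {v₁ : V₁} (hv₁ : ‖v₁‖ = 1) (v₂ : V₂) : a v₁ v₂ ≤ ‖v₂‖ := by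
  rw [hadj v₂]
  refine le_csSup ⟨‖a‖ * ‖v₂‖, ?_⟩ ⟨v₁, hv₁, rfl⟩
  rintro _ ⟨φ, hφ, rfl⟩
  have := (le_abs_self _).trans (a.le_opNorm₂ φ v₂)
  rwa [hφ, mul_one] at this

lemma discInfSup_bddBelow (Vh1 : Submodule ℝ V₁) (Vh2 : Submodule ℝ V₂) :
    BddBelow {r : ℝ | ∃ v₁ ∈ Vh1, ‖v₁‖ = 1 ∧
      r = sSup {s : ℝ | ∃ φ₂ ∈ Vh2, ‖φ₂‖ = 1 ∧ s = a v₁ φ₂}} := by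
  refine ⟨-‖a‖, ?_⟩
  rintro _ ⟨v, -, hv, rfl⟩
  have hbd : ∀ φ : V₂, ‖φ‖ = 1 → |a v φ| ≤ ‖a‖ := fun φ hφ => by
    simpa [hv, hφ] using a.le_opNorm₂ v φ
  rcases Set.eq_empty_or_nonempty {s : ℝ | ∃ φ₂ ∈ Vh2, ‖φ₂‖ = 1 ∧ s = a v φ₂} with h | ⟨s, hs⟩
  · rw [h, Real.sSup_empty]
    exact neg_nonpos.2 (norm_nonneg a)
  · obtain ⟨φ, -, hφ, hsφ⟩ := id hs
    refine le_csSup_of_le ⟨‖a‖, ?_⟩ hs (hsφ ▸ neg_le_of_abs_le (hbd φ hφ))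
    rintro _ ⟨ψ, -, hψ, rfl⟩
    exact (le_abs_self _).trans (hbd ψ hψ)

lemma discInfSup_le_one
    (hadj : ∀ v₂ : V₂, ‖v₂‖ = sSup {r : ℝ | ∃ φ₁ : V₁, ‖φ₁‖ = 1 ∧ r = a φ₁ v₂}) :
    discInfSup a Vh1 Vh2 ≤ 1 := by
  rcases Set.eq_empty_or_nonempty {r : ℝ | ∃ v₁ ∈ Vh1, ‖v₁‖ = 1 ∧
    r = sSup {s : ℝ | ∃ φ₂ ∈ Vh2, ‖φ₂‖ = 1 ∧ s = a v₁ φ₂}} with h | ⟨r, hr⟩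
  · rw [discInfSup, h, Real.sInf_empty]
    exact zero_le_one
  · refine csInf_le_of_le (discInfSup_bddBelow a Vh1 Vh2) hr ?_
    obtain ⟨v, -, hv, rfl⟩ := hr
    refine Real.sSup_le ?_ zero_le_one
    rintro _ ⟨φ, -, hφ, rfl⟩
    exact (apply_le_of_norm_eq_sSup a hadj hv φ).trans hφ.le

lemma discInfSup_mul_norm_le {v : V₁} (hv : v ∈ Vh1) {c : ℝ} (hc : 0 ≤ c)
    (h : ∀ φ ∈ Vh2, a v φ ≤ c * ‖φ‖) : discInfSup a Vh1 Vh2 * ‖v‖ ≤ c := by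
  rcases eq_or_ne v 0 with rfl | hv0
  · simpa using hc
  have hn : 0 < ‖v‖ := norm_pos_iff.2 hv0
  rw [← le_div_iff₀ hn]
  refine csInf_le_of_le (discInfSup_bddBelow a Vh1 Vh2)
    ⟨‖v‖⁻¹ • v, Vh1.smul_mem _ hv, norm_smul_inv_norm hv0, rfl⟩ ?_
  refine Real.sSup_le ?_ (by positivity)
  rintro _ ⟨φ, hφ, hφ1, rfl⟩
  have := h φ hφ
  rw [hφ1, mul_one] at this
  rw [map_smul, smul_apply, smul_eq_mul, div_eq_inv_mul]
  gcongr

lemma exists_apply_eq_of_nondegenerate [FiniteDimensional ℝ Vh1] [FiniteDimensional ℝ Vh2]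
    (h1 : ∀ v₁ ∈ Vh1, (∀ φ₂ ∈ Vh2, a v₁ φ₂ = 0) → v₁ = 0)
    (h2 : ∀ v₂ ∈ Vh2, (∀ φ₁ ∈ Vh1, a φ₁ v₂ = 0) → v₂ = 0) (f : V₂ →L[ℝ] ℝ) :
    ∃ v₁ ∈ Vh1, ∀ φ₂ ∈ Vh2, a v₁ φ₂ = f φ₂ := by
  let B : Vh1 →ₗ[ℝ] Vh2 →ₗ[ℝ] ℝ :=
    LinearMap.mk₂ ℝ (fun v φ => a v φ) (by simp) (by simp) (by simp) (by simp)
  have hB : Function.Injective B := by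
    refine (injective_iff_map_eq_zero B).2 fun v hv => Subtype.ext (h1 v v.2 fun φ hφ => ?_)
    exact LinearMap.congr_fun hv ⟨φ, hφ⟩
  have hB' : Function.Injective B.flip := by
    refine (injective_iff_map_eq_zero B.flip).2 fun v hv => Subtype.ext (h2 v v.2 fun φ hφ => ?_)
    exact LinearMap.congr_fun hv ⟨φ, hφ⟩
  have := LinearMap.IsPerfPair.of_injective hB hB'
  obtain ⟨v, hv⟩ := (LinearMap.IsPerfPair.bijective_left B).surjective
    ((f : V₂ →ₗ[ℝ] ℝ).domRestrict Vh2)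
  exact ⟨v, v.2, fun φ hφ => LinearMap.congr_fun hv ⟨φ, hφ⟩⟩

/-- Inf-sup stability of `aV` on the product of the discrete spaces. -/
lemma discInfSup_mul_nV_le [FiniteDimensional ℝ Vh1] [FiniteDimensional ℝ Vh2]
    (h1 : ∀ v₁ ∈ Vh1, (∀ φ₂ ∈ Vh2, a v₁ φ₂ = 0) → v₁ = 0)
    (h2 : ∀ v₂ ∈ Vh2, (∀ φ₁ ∈ Vh1, a φ₁ v₂ = 0) → v₂ = 0)
    (hm : 0 < discInfSup a Vh1 Vh2) {e : V₁ × V₂} (he1 : e.1 ∈ Vh1) (he2 : e.2 ∈ Vh2)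
    {c : ℝ} (hc : 0 ≤ c)
    (h : ∀ φ : V₁ × V₂, φ.1 ∈ Vh1 → φ.2 ∈ Vh2 → aV a e φ ≤ c * nV φ) :
    discInfSup a Vh1 Vh2 * nV e ≤ c := by
  set m := discInfSup a Vh1 Vh2 with hmdef
  obtain ⟨p, hp, hpe⟩ := exists_apply_eq_of_nondegenerate a h1 h2 (innerSL ℝ e.2)
  obtain ⟨q, hq, hqe⟩ := exists_apply_eq_of_nondegenerate a.flip (Vh1 := Vh2) (Vh2 := Vh1)
    h2 h1 (innerSL ℝ e.1)
  simp only [innerSL_apply_apply, ContinuousLinearMap.flip_apply] at hpe hqe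
  have hpn : m * ‖p‖ ≤ ‖e.2‖ := discInfSup_mul_norm_le a hp (norm_nonneg _) fun φ hφ => by
    rw [hpe φ hφ]; exact real_inner_le_norm _ _
  have hqn : m * ‖q‖ ≤ ‖e.1‖ := by
    obtain ⟨w, hw, hwq⟩ := exists_apply_eq_of_nondegenerate a h1 h2 (innerSL ℝ q)
    simp only [innerSL_apply_apply] at hwq
    have hwn : m * ‖w‖ ≤ ‖q‖ := discInfSup_mul_norm_le a hw (norm_nonneg _) fun φ hφ => by
      rw [hwq φ hφ]; exact real_inner_le_norm _ _
    have hqq : ‖q‖ ^ 2 ≤ ‖e.1‖ * ‖w‖ := by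
      rw [← real_inner_self_eq_norm_sq, ← hwq q hq, hqe w hw]
      exact real_inner_le_norm _ _
    rcases (norm_nonneg q).eq_or_lt with h₀ | h₀
    · rw [← h₀, mul_zero]; exact norm_nonneg _
    · refine le_of_mul_le_mul_right ?_ h₀
      calc m * ‖q‖ * ‖q‖ = m * ‖q‖ ^ 2 := by ring
        _ ≤ m * (‖e.1‖ * ‖w‖) := by gcongr
        _ = ‖e.1‖ * (m * ‖w‖) := by ring
        _ ≤ ‖e.1‖ * ‖q‖ := by gcongr
  have hpq : m * nV (p, q) ≤ nV e := by
    rw [nV, nV]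
    refine Real.le_sqrt_of_sq_le ?_
    rw [mul_pow, Real.sq_sqrt (by positivity)]
    have := pow_le_pow_left₀ (by positivity) hpn 2
    have := pow_le_pow_left₀ (by positivity) hqn 2
    simp only
    linarith
  have hee : aV a e (p, q) = nV e ^ 2 := by
    rw [nV, Real.sq_sqrt (by positivity), aV]
    simp only
    rw [hpe _ he2, hqe _ he1, real_inner_self_eq_norm_sq, real_inner_self_eq_norm_sq]
  have hle := h (p, q) hp hq
  rw [hee] at hle
  rcases (Real.sqrt_nonneg (‖e.1‖ ^ 2 + ‖e.2‖ ^ 2)).eq_or_lt with h₀ | h₀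
  · rw [nV, ← h₀, mul_zero]; exact hc
  · refine le_of_mul_le_mul_right (a := nV e) ?_ h₀
    calc m * nV e * nV e = m * nV e ^ 2 := by ring
      _ ≤ m * (c * nV (p, q)) := by gcongr
      _ = c * (m * nV (p, q)) := by ring
      _ ≤ c * nV e := by gcongr

end DiscreteInfSup

section Estimates

lemma mul_add_mul_le_sqrt_mul_sqrt (a b c d : ℝ) :
    a * b + c * d ≤ √(a ^ 2 + c ^ 2) * √(b ^ 2 + d ^ 2) := by
  rw [← Real.sqrt_mul (by positivity)]
  exact Real.le_sqrt_of_sq_le (by nlinarith [sq_nonneg (a * d - b * c)])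

variable {V₁ V₂ Q W : Type*}
  [NormedAddCommGroup V₁] [InnerProductSpace ℝ V₁]
  [NormedAddCommGroup V₂] [InnerProductSpace ℝ V₂]
  [NormedAddCommGroup Q] [InnerProductSpace ℝ Q]
  [NormedAddCommGroup W] [InnerProductSpace ℝ W]
  (Cs : V₂ →L[ℝ] Q) (Iop : V₁ →L[ℝ] W) {PK : Q → Q} {α : ℝ}

lemma sV_le_max_mul_nV (v : V₁ × V₂) : sV Cs Iop v ≤ max ‖Iop‖ ‖Cs‖ * nV v := by
  set M := max ‖Iop‖ ‖Cs‖
  have hM : 0 ≤ M := (norm_nonneg Iop).trans (le_max_left _ _)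
  have h1 : ‖Iop v.1‖ ≤ M * ‖v.1‖ := Iop.le_of_opNorm_le (le_max_left _ _) _
  have h2 : ‖Cs v.2‖ ≤ M * ‖v.2‖ := Cs.le_of_opNorm_le (le_max_right _ _) _
  rw [sV, nV]
  refine Real.sqrt_le_iff.2 ⟨by positivity, ?_⟩
  rw [mul_pow, Real.sq_sqrt (by positivity)]
  have := pow_le_pow_left₀ (by positivity) h1 2
  have := pow_le_pow_left₀ (by positivity) h2 2
  linarith

lemma cK_sub_cK_le (hα : 0 < α) (v w φ : V₁ × V₂) :
    cK Cs Iop PK α v φ - cK Cs Iop PK α w φ ≤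
      (√α)⁻¹ * (deltaK Cs Iop PK α v w * sV Cs Iop φ) := by
  have hs : 0 < √α := Real.sqrt_pos.2 hα
  set P := PK ((-(√α)⁻¹) • Cs v.2) - PK ((-(√α)⁻¹) • Cs w.2) with hP
  have hrep : cK Cs Iop PK α v φ - cK Cs Iop PK α w φ =
      -⟪P, Cs φ.2⟫ - (√α)⁻¹ * ⟪Iop (v.1 - w.1), Iop φ.1⟫ := by
    simp only [cK, hP, map_sub, inner_sub_left]
    ring
  have h1 := neg_le_of_abs_le (abs_real_inner_le_norm P (Cs φ.2))
  have h2 := neg_le_of_abs_le (abs_real_inner_le_norm (Iop (v.1 - w.1)) (Iop φ.1))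
  have hcs := mul_add_mul_le_sqrt_mul_sqrt (‖Iop (v.1 - w.1)‖) (‖Iop φ.1‖) (√α * ‖P‖) (‖Cs φ.2‖)
  have hδ : √(‖Iop (v.1 - w.1)‖ ^ 2 + (√α * ‖P‖) ^ 2) = deltaK Cs Iop PK α v w := by
    rw [deltaK, mul_pow, Real.sq_sqrt hα.le, add_comm]
  rw [hδ] at hcs
  rw [hrep]
  calc -⟪P, Cs φ.2⟫ - (√α)⁻¹ * ⟪Iop (v.1 - w.1), Iop φ.1⟫
      = -⟪P, Cs φ.2⟫ + (√α)⁻¹ * -⟪Iop (v.1 - w.1), Iop φ.1⟫ := by ring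
    _ ≤ ‖P‖ * ‖Cs φ.2‖ + (√α)⁻¹ * (‖Iop (v.1 - w.1)‖ * ‖Iop φ.1‖) := by
        gcongr <;> linarith
    _ = (√α)⁻¹ * (‖Iop (v.1 - w.1)‖ * ‖Iop φ.1‖ + √α * ‖P‖ * ‖Cs φ.2‖) := by
        field_simp
        ring
    _ ≤ _ := by gcongr; exact hcs

lemma deltaK_comm (v w : V₁ × V₂) : deltaK Cs Iop PK α v w = deltaK Cs Iop PK α w v := by
  rw [deltaK, deltaK, norm_sub_rev, map_sub, map_sub, norm_sub_rev (Iop v.1)]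

variable {K : Set Q}

lemma deltaK_le_sV_sub (hα : 0 < α) (hK : Convex ℝ K) (hmem : ∀ q, PK q ∈ K)
    (hmin : ∀ q : Q, ∀ p ∈ K, ‖q - PK q‖ ≤ ‖q - p‖) (v w : V₁ × V₂) :
    deltaK Cs Iop PK α v w ≤ sV Cs Iop (v - w) := by
  have hs : 0 < √α := Real.sqrt_pos.2 hα
  have h := norm_proj_sub_proj_le hK hmem hmin ((-(√α)⁻¹) • Cs v.2) ((-(√α)⁻¹) • Cs w.2)
  rw [← smul_sub, ← map_sub, norm_smul, norm_neg, norm_inv, Real.norm_of_nonneg hs.le] at h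
  have h2 := pow_le_pow_left₀ (norm_nonneg _) h 2
  rw [deltaK, sV]
  refine Real.sqrt_le_sqrt ?_
  rw [add_comm, Prod.fst_sub, Prod.snd_sub]
  gcongr
  refine (mul_le_mul_of_nonneg_left h2 hα.le).trans_eq ?_
  rw [mul_pow, inv_pow, Real.sq_sqrt hα.le]
  field_simp

lemma deltaK_sq_le_cK_sub_cK (hα : 0 < α) (hK : Convex ℝ K) (hmem : ∀ q, PK q ∈ K)
    (hmin : ∀ q : Q, ∀ p ∈ K, ‖q - PK q‖ ≤ ‖q - p‖) (v w : V₁ × V₂) :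
    (√α)⁻¹ * deltaK Cs Iop PK α v w ^ 2 ≤
      cK Cs Iop PK α v (-(v.1 - w.1), v.2 - w.2) -
        cK Cs Iop PK α w (-(v.1 - w.1), v.2 - w.2) := by
  have hs : 0 < √α := Real.sqrt_pos.2 hα
  have h := norm_proj_sub_proj_sq_le_inner hK hmem hmin
    ((-(√α)⁻¹) • Cs v.2) ((-(√α)⁻¹) • Cs w.2)
  rw [← smul_sub, ← map_sub, inner_smul_right] at h
  rw [deltaK, Real.sq_sqrt (by positivity)]
  set P := PK ((-(√α)⁻¹) • Cs v.2) - PK ((-(√α)⁻¹) • Cs w.2) with hP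
  have hrep : cK Cs Iop PK α v (-(v.1 - w.1), v.2 - w.2) -
      cK Cs Iop PK α w (-(v.1 - w.1), v.2 - w.2) =
      -⟪P, Cs (v.2 - w.2)⟫ + (√α)⁻¹ * ‖Iop (v.1 - w.1)‖ ^ 2 := by
    rw [← real_inner_self_eq_norm_sq]
    simp only [cK, hP, map_neg, map_sub, inner_sub_left, inner_neg_right]
    ring
  rw [hrep, mul_add]
  gcongr
  have h3 := mul_le_mul_of_nonneg_left h hs.le
  calc (√α)⁻¹ * (α * ‖P‖ ^ 2) = (√α)⁻¹ * (√α ^ 2 * ‖P‖ ^ 2) := by rw [Real.sq_sqrt hα.le]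
    _ = √α * ‖P‖ ^ 2 := by field_simp
    _ ≤ _ := h3
    _ = _ := by field_simp

lemma le_mul_of_sq_le_mul_add {p T D δ : ℝ} (hD : 0 ≤ D) (hp : 0 ≤ p)
    (hpT : p ≤ T) (hT : p * (1 + T) ≤ T ^ 2) (h : δ ^ 2 ≤ p * D * (D + δ)) : δ ≤ T * D := by
  by_contra! hlt
  have hTD : 0 ≤ T * D := mul_nonneg (hp.trans hpT) hD
  have h1 : p * (1 + T) * D ^ 2 ≤ T ^ 2 * D ^ 2 := by gcongr
  have h2 : p * D ≤ T * D := by gcongr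
  nlinarith [mul_pos (sub_pos.2 hlt) (hTD.trans_lt hlt),
    mul_nonneg (sub_pos.2 hlt).le (sub_nonneg.2 h2)]

lemma add_mul_le_of_quadratic_bounds {n δ D L M μ : ℝ} (hδ : 0 ≤ δ) (hD : 0 ≤ D) (hL : 0 ≤ L)
    (hM : 0 ≤ M) (hμ : 1 ≤ μ) (h1 : n ≤ μ * (L * (D + δ))) (h2 : δ ^ 2 ≤ M * D * n) :
    n + L * δ ≤ (1 + 2 * L) / (1 + L) * (1 + M * (1 + 2 * L) * μ) * μ * L * D := by
  have hμ0 : 0 ≤ μ := zero_le_one.trans hμ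
  obtain ⟨y, hy⟩ : ∃ y, y = M * μ := ⟨_, rfl⟩
  have hy0 : 0 ≤ y := hy ▸ mul_nonneg hM hμ0
  obtain ⟨T, hT⟩ : ∃ T, T = (L + y * (1 + 2 * L) ^ 2) / (2 * (1 + L)) := ⟨_, rfl⟩
  have hpT : y * L ≤ T := by
    rw [hT, le_div_iff₀ (by positivity)]
    nlinarith [mul_nonneg hy0 hL, mul_nonneg (mul_nonneg hy0 hL) hL]
  have hTT : y * L * (1 + T) ≤ T ^ 2 := by
    have : T ^ 2 - y * L * (1 + T) =
        ((L + y * (L ^ 2 - L - 1)) ^ 2 +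
          y ^ 2 * ((1 + 2 * L) ^ 2 * (1 + 2 * L + 2 * L ^ 2) - (L ^ 2 - L - 1) ^ 2)) /
          (2 * (1 + L)) ^ 2 := by
      rw [hT]
      field_simp
      ring
    have hpos : 0 ≤ (1 + 2 * L) ^ 2 * (1 + 2 * L + 2 * L ^ 2) - (L ^ 2 - L - 1) ^ 2 := by
      ring_nf
      positivity
    have : 0 ≤ T ^ 2 - y * L * (1 + T) := by rw [this]; positivity
    linarith
  have hδT : δ ≤ T * D := by
    refine le_mul_of_sq_le_mul_add hD (by positivity) hpT hTT (h2.trans ?_)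
    calc M * D * n ≤ M * D * (μ * (L * (D + δ))) := by gcongr
      _ = y * L * D * (D + δ) := by rw [hy]; ring
  calc n + L * δ ≤ μ * (L * (D + δ)) + μ * (L * δ) :=
        add_le_add h1 (le_mul_of_one_le_left (by positivity) hμ)
    _ = μ * L * (D + 2 * δ) := by ring
    _ ≤ μ * L * (D + 2 * (T * D)) := by gcongr
    _ = _ := by
        rw [hT, hy]
        field_simp
        ring

end Estimates

/-- Lemma 5.5, nonlinear variational and generalized Ritz
approximations: `d_{K,α}(x_h, R_h x) ≤ κ_h μ_h (M/√α) |x − R_h x|`. -/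
theorem stmt17
    {V₁ V₂ Q W : Type*}
    [NormedAddCommGroup V₁] [InnerProductSpace ℝ V₁] [CompleteSpace V₁] [Nontrivial V₁]
    [NormedAddCommGroup V₂] [InnerProductSpace ℝ V₂] [CompleteSpace V₂] [Nontrivial V₂]
    [NormedAddCommGroup Q] [InnerProductSpace ℝ Q] [CompleteSpace Q]
    [NormedAddCommGroup W] [InnerProductSpace ℝ W] [CompleteSpace W]
    (a : V₁ →L[ℝ] V₂ →L[ℝ] ℝ) (Cs : V₂ →L[ℝ] Q) (Iop : V₁ →L[ℝ] W)
    (α m_a M_C M_I M L : ℝ) (hα : 0 < α)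
    (hma : m_a = infSupConst a) (hma_pos : 0 < m_a)
    (hnd : ∀ v₁ : V₁, (∀ v₂ : V₂, a v₁ v₂ = 0) → v₁ = 0)
    (hadj : ∀ v₂ : V₂, ‖v₂‖ = sSup {r : ℝ | ∃ φ₁ : V₁, ‖φ₁‖ = 1 ∧ r = a φ₁ v₂})
    (hMC : M_C = ‖Cs‖) (hMI : M_I = ‖Iop‖) (hM : M = max M_I M_C)
    (hL : L = M / Real.sqrt α)
    (K : Set Q) (hK_ne : K.Nonempty) (hK_cl : IsClosed K) (hK_cx : Convex ℝ K)
    (PK : Q → Q) (hPK_mem : ∀ q, PK q ∈ K)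
    (hPK : ∀ q : Q, ∀ p ∈ K, ‖q - PK q‖ ≤ ‖q - p‖)
    (Vh1 : Submodule ℝ V₁) (Vh2 : Submodule ℝ V₂)
    [FiniteDimensional ℝ Vh1] [FiniteDimensional ℝ Vh2]
    (hndh1 : ∀ v₁ ∈ Vh1, (∀ φ₂ ∈ Vh2, a v₁ φ₂ = 0) → v₁ = 0)
    (hndh2 : ∀ v₂ ∈ Vh2, (∀ φ₁ ∈ Vh1, a φ₁ v₂ = 0) → v₂ = 0)
    (μh κh : ℝ) (hμh_pos : 0 < μh)
    (hμh : 1 / μh = discInfSup a Vh1 Vh2)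
    (hκh : κh = ((1 + 2 * L) / (1 + L)) * (1 + M * (1 + 2 * M / Real.sqrt α) * μh))
    (u_d : W) (x xh : V₁ × V₂)
    (hx : ∀ φ : V₁ × V₂, bK a Cs Iop PK α x φ = -(Real.sqrt α)⁻¹ * ⟪u_d, Iop φ.1⟫)
    (hxh_mem : xh.1 ∈ Vh1 ∧ xh.2 ∈ Vh2)
    (hxh : ∀ φh : V₁ × V₂, φh.1 ∈ Vh1 → φh.2 ∈ Vh2 →
      bK a Cs Iop PK α xh φh = -(Real.sqrt α)⁻¹ * ⟪u_d, Iop φh.1⟫)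
    -- the generalized Ritz projection of x
    (Rx : V₁ × V₂) (hRx_mem : Rx.1 ∈ Vh1 ∧ Rx.2 ∈ Vh2)
    (hRx1 : ∀ φ₂ ∈ Vh2, a Rx.1 φ₂ = a x.1 φ₂)
    (hRx2 : ∀ φ₁ ∈ Vh1, a φ₁ Rx.2 = a φ₁ x.2) :
    nV (xh - Rx) + (M / Real.sqrt α) * deltaK Cs Iop PK α xh Rx ≤
      κh * μh * (M / Real.sqrt α) * sV Cs Iop (x - Rx) := by
  have hs : 0 < √α := Real.sqrt_pos.2 hα
  have hM0 : 0 ≤ M := by rw [hM, hMI]; exact (norm_nonneg _).trans (le_max_left _ _)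
  have hL0 : 0 ≤ L := by rw [hL]; positivity
  have hsV : ∀ v : V₁ × V₂, sV Cs Iop v ≤ M * nV v := by
    rw [hM, hMI, hMC]; exact sV_le_max_mul_nV Cs Iop
  have hm_pos : 0 < discInfSup a Vh1 Vh2 := hμh ▸ one_div_pos.2 hμh_pos
  have hμ1 : 1 ≤ μh := by
    have := hμh.le.trans (discInfSup_le_one a hadj)
    rwa [div_le_one hμh_pos] at this
  have haR : ∀ φ : V₁ × V₂, φ.1 ∈ Vh1 → φ.2 ∈ Vh2 →
      aV a (xh - Rx) φ = cK Cs Iop PK α x φ - cK Cs Iop PK α xh φ := by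
    intro φ hφ1 hφ2
    have h1 := hx φ
    have h2 := hxh φ hφ1 hφ2
    have h3 := hRx1 φ.2 hφ2
    have h4 := hRx2 φ.1 hφ1
    simp only [bK, aV, Prod.fst_sub, Prod.snd_sub, map_sub, sub_apply] at *
    linarith
  set e := xh - Rx with he
  have he1 : e.1 ∈ Vh1 := Vh1.sub_mem hxh_mem.1 hRx_mem.1
  have he2 : e.2 ∈ Vh2 := Vh2.sub_mem hxh_mem.2 hRx_mem.2
  set δ := deltaK Cs Iop PK α xh Rx with hδ
  set D := sV Cs Iop (x - Rx) with hD
  have hδ0 : 0 ≤ δ := Real.sqrt_nonneg _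
  have hD0 : 0 ≤ D := Real.sqrt_nonneg _
  have hxR : ∀ φ, cK Cs Iop PK α x φ - cK Cs Iop PK α Rx φ ≤ (√α)⁻¹ * (D * sV Cs Iop φ) := by
    intro φ
    refine (cK_sub_cK_le Cs Iop hα x Rx φ).trans ?_
    have := deltaK_le_sV_sub Cs Iop hα hK_cx hPK_mem hPK x Rx
    have : 0 ≤ sV Cs Iop φ := Real.sqrt_nonneg _
    gcongr
  have hn : nV e ≤ μh * (L * (D + δ)) := by
    have h := discInfSup_mul_nV_le a hndh1 hndh2 hm_pos he1 he2 (c := L * (D + δ))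
      (by positivity) fun φ hφ1 hφ2 => ?_
    · rwa [← hμh, one_div, inv_mul_le_iff₀ hμh_pos] at h
    · rw [haR φ hφ1 hφ2]
      have h1 := hxR φ
      have h2 := cK_sub_cK_le Cs Iop (PK := PK) hα Rx xh φ
      rw [deltaK_comm, ← hδ] at h2
      calc cK Cs Iop PK α x φ - cK Cs Iop PK α xh φ
          ≤ (√α)⁻¹ * (D + δ) * sV Cs Iop φ := by linarith
        _ ≤ (√α)⁻¹ * (D + δ) * (M * nV φ) := by gcongr; exact hsV φ
        _ = L * (D + δ) * nV φ := by rw [hL]; ring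
  have hq : δ ^ 2 ≤ M * D * nV e := by
    have h1 := deltaK_sq_le_cK_sub_cK Cs Iop hα hK_cx hPK_mem hPK xh Rx
    have h2 := haR (-e.1, e.2) (Vh1.neg_mem he1) he2
    have h3 := hxR (-e.1, e.2)
    have h4 : aV a e (-e.1, e.2) = 0 := by simp [aV]
    have h5 : sV Cs Iop (-e.1, e.2) = sV Cs Iop e := by simp [sV]
    rw [h5] at h3
    change (√α)⁻¹ * δ ^ 2 ≤ cK Cs Iop PK α xh (-e.1, e.2) - cK Cs Iop PK α Rx (-e.1, e.2) at h1
    have h6 : (√α)⁻¹ * δ ^ 2 ≤ (√α)⁻¹ * (D * sV Cs Iop e) := by linarith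
    calc δ ^ 2 ≤ D * sV Cs Iop e := le_of_mul_le_mul_left h6 (inv_pos.2 hs)
      _ ≤ D * (M * nV e) := by gcongr; exact hsV e
      _ = M * D * nV e := by ring
  have h := add_mul_le_of_quadratic_bounds hδ0 hD0 hL0 hM0 hμ1 hn hq
  rw [hκh, mul_div_assoc, ← hL]
  exact h
end

section
/- Assume I : V₁ → W and C* : V₂ → Q are compact, uniform stability (μ_h ≤ μ̄ for all h > 0) and approximability (for every v ∈ V, inf_{v_h ∈ V_h}‖v − v_h‖ → 0 as h → 0); set κ̄ = ((1+2L)/(1+L))·(1 + M(1 + 2M/√α)·μ̄) with L = M/√α. Let x ∈ V solve b_K(x,φ) = −α^{−1/2}⟨u_d, Iφ₁⟩_W for all φ ∈ V and, for each h, let x_h ∈ V_h solve b_K(x_h,φ_h) = −α^{−1/2}⟨u_d, Iφ_{h,1}⟩_W for all φ_h ∈ V_h. Then there exists ε : (0,∞) → [0,∞) with ε(h) → 0 as h → 0 such that d_{K,α}(x_h, R_h x) ≤ (M/√α)·κ̄·μ̄·ε(h)·‖x − R_h x‖ for all h (supercloseness of the nonlinear variational discretization to the generalized Ritz projection). -/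
open scoped RealInnerProductSpace
open Filter Topology

section NormV

variable {V₁ V₂ : Type*} [NormedAddCommGroup V₁] [NormedAddCommGroup V₂]

theorem nV_nonneg (v : V₁ × V₂) : 0 ≤ nV v := Real.sqrt_nonneg _

theorem norm_fst_le_nV (v : V₁ × V₂) : ‖v.1‖ ≤ nV v :=
  Real.le_sqrt_of_sq_le (by nlinarith [sq_nonneg ‖v.2‖])

theorem norm_snd_le_nV (v : V₁ × V₂) : ‖v.2‖ ≤ nV v :=
  Real.le_sqrt_of_sq_le (by nlinarith [sq_nonneg ‖v.1‖])

theorem nV_le_add (v : V₁ × V₂) : nV v ≤ ‖v.1‖ + ‖v.2‖ := by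
  refine Real.sqrt_le_iff.2 ⟨by positivity, ?_⟩
  nlinarith [norm_nonneg v.1, norm_nonneg v.2]

end NormV

section Helpers

variable {V₁ V₂ Q W : Type*}
  [NormedAddCommGroup V₁] [InnerProductSpace ℝ V₁]
  [NormedAddCommGroup V₂] [InnerProductSpace ℝ V₂]
  [NormedAddCommGroup Q] [InnerProductSpace ℝ Q]
  [NormedAddCommGroup W] [InnerProductSpace ℝ W]

/-- The metric projection onto a convex set is firmly nonexpansive. -/
theorem norm_sq_le_inner_of_metric_projection {K : Set Q} (hK : Convex ℝ K) {P : Q → Q}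
    (hPK : ∀ q, P q ∈ K) (hP : ∀ q : Q, ∀ p ∈ K, ‖q - P q‖ ≤ ‖q - p‖) (p q : Q) :
    ‖P p - P q‖ ^ 2 ≤ ⟪P p - P q, p - q⟫ := by
  have key : ∀ u : Q, ∀ w ∈ K, ⟪u - P u, w - P u⟫ ≤ 0 := by
    intro u
    refine (norm_eq_iInf_iff_real_inner_le_zero hK (hPK u)).1 ?_
    have : Nonempty K := ⟨⟨P u, hPK u⟩⟩
    refine le_antisymm (le_ciInf fun w => hP u w w.2) ?_
    exact ciInf_le (f := fun w : K => ‖u - w‖)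
      ⟨0, by rintro _ ⟨w, rfl⟩; exact norm_nonneg _⟩ ⟨P u, hPK u⟩
  have h1 := key p (P q) (hPK q)
  have h2 := key q (P p) (hPK p)
  rw [← real_inner_self_eq_norm_sq]
  simp only [inner_sub_left, inner_sub_right] at *
  linarith [real_inner_comm p (P p), real_inner_comm p (P q), real_inner_comm q (P p),
    real_inner_comm q (P q), real_inner_comm (P p) (P q)]

/-- The metric projection onto a convex set is nonexpansive. -/
theorem norm_sub_le_of_metric_projection {K : Set Q} (hK : Convex ℝ K) {P : Q → Q}
    (hPK : ∀ q, P q ∈ K) (hP : ∀ q : Q, ∀ p ∈ K, ‖q - P q‖ ≤ ‖q - p‖) (p q : Q) :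
    ‖P p - P q‖ ≤ ‖p - q‖ := by
  have h := norm_sq_le_inner_of_metric_projection hK hPK hP p q
  have h2 := real_inner_le_norm (P p - P q) (p - q)
  rcases (norm_nonneg (P p - P q)).eq_or_lt with h0 | h0
  · rw [← h0]; exact norm_nonneg _
  · exact le_of_mul_le_mul_left (by nlinarith) h0

/-- A bilinear form, nondegenerate in its first argument, for which the second space carries
the adjoint norm, is the inner product up to a linear isometry equivalence. -/
theorem exists_linearIsometryEquiv_of_adjoint_norm [CompleteSpace V₁] [CompleteSpace V₂]
    [Nontrivial V₁] (a : V₁ →L[ℝ] V₂ →L[ℝ] ℝ)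
    (hnd : ∀ v₁ : V₁, (∀ v₂ : V₂, a v₁ v₂ = 0) → v₁ = 0)
    (hadj : ∀ v₂ : V₂, ‖v₂‖ = sSup {r : ℝ | ∃ φ₁ : V₁, ‖φ₁‖ = 1 ∧ r = a φ₁ v₂}) :
    ∃ J : V₂ ≃ₗᵢ[ℝ] V₁, ∀ v₁ v₂, a v₁ v₂ = ⟪v₁, J v₂⟫ := by
  let A : V₂ →ₗ[ℝ] V₁ :=
    ((InnerProductSpace.toDual ℝ V₁).symm.toLinearEquiv.toLinearMap).comp
      a.flip.toLinearMap
  have hA : ∀ v₁ v₂, a v₁ v₂ = ⟪v₁, A v₂⟫ := by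
    intro v₁ v₂
    rw [real_inner_comm]
    change _ = ⟪(InnerProductSpace.toDual ℝ V₁).symm (a.flip v₂), v₁⟫
    rw [InnerProductSpace.toDual_symm_apply]
    rfl
  have hnorm : ∀ v₂, ‖A v₂‖ = ‖v₂‖ := by
    intro v₂
    have hub : ∀ r ∈ {r : ℝ | ∃ φ₁ : V₁, ‖φ₁‖ = 1 ∧ r = a φ₁ v₂}, r ≤ ‖A v₂‖ := by
      rintro r ⟨φ, hφ, rfl⟩
      rw [hA]
      simpa [hφ] using real_inner_le_norm φ (A v₂)
    obtain ⟨u, hu⟩ := exists_norm_eq V₁ (zero_le_one (α := ℝ))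
    rw [hadj v₂]
    refine le_antisymm ?_ (csSup_le ⟨_, u, hu, rfl⟩ hub)
    by_cases h0 : A v₂ = 0
    · refine le_csSup ⟨_, hub⟩ ⟨u, hu, ?_⟩
      rw [hA, h0]; simp
    · refine le_csSup ⟨_, hub⟩ ⟨‖A v₂‖⁻¹ • A v₂, norm_smul_inv_norm h0, ?_⟩
      rw [hA, real_inner_smul_left, real_inner_self_eq_norm_sq]
      have := norm_ne_zero_iff.2 h0
      field_simp
  let Ai : V₂ →ₗᵢ[ℝ] V₁ := ⟨A, hnorm⟩
  have hcl : IsClosed (LinearMap.range A : Set V₁) := by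
    have := Ai.isometry.isClosedEmbedding.isClosed_range
    rwa [LinearMap.coe_range]
  have : CompleteSpace (LinearMap.range A) := hcl.completeSpace_coe
  have hsurj : Function.Surjective Ai := by
    have : LinearMap.range A = ⊤ := by
      rw [← Submodule.orthogonal_eq_bot_iff, Submodule.eq_bot_iff]
      intro v hv
      refine hnd v fun v₂ => ?_
      rw [hA, real_inner_comm]
      exact (Submodule.mem_orthogonal _ _).1 hv _ ⟨v₂, rfl⟩
    exact LinearMap.range_eq_top.1 this
  exact ⟨LinearIsometryEquiv.ofSurjective Ai hsurj, fun v₁ v₂ => hA v₁ v₂⟩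

/-- Stability in the first argument from a positive lower bound on the discrete inf-sup
constant. -/
theorem norm_le_of_discInfSup (a : V₁ →L[ℝ] V₂ →L[ℝ] ℝ) (U : Submodule ℝ V₁)
    (X : Submodule ℝ V₂) {m : ℝ} (hm : 0 < m) (h : 1 / m = discInfSup a U X) {v : V₁}
    (hv : v ∈ U) {r : ℝ} (hr : ∀ φ ∈ X, a v φ ≤ r * ‖φ‖) : ‖v‖ ≤ m * r := by
  have hbdd : BddBelow {r : ℝ | ∃ v₁ ∈ U, ‖v₁‖ = 1 ∧
      r = sSup {s : ℝ | ∃ φ₂ ∈ X, ‖φ₂‖ = 1 ∧ s = a v₁ φ₂}} := by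
    refine ⟨0, ?_⟩
    rintro _ ⟨v₁, -, hv₁, rfl⟩
    by_cases hne : ∃ φ ∈ X, ‖φ‖ = 1
    · obtain ⟨φ, hφ, hφ1⟩ := hne
      have hb : BddAbove {s : ℝ | ∃ φ₂ ∈ X, ‖φ₂‖ = 1 ∧ s = a v₁ φ₂} := by
        refine ⟨‖a v₁‖, ?_⟩
        rintro _ ⟨ψ, -, hψ, rfl⟩
        simpa [hψ] using (le_abs_self _).trans ((a v₁).le_opNorm ψ)
      have h1 := le_csSup hb ⟨φ, hφ, hφ1, rfl⟩
      have h2 := le_csSup hb ⟨-φ, X.neg_mem hφ, by rwa [norm_neg], rfl⟩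
      rw [map_neg] at h2
      linarith
    · refine Real.sSup_nonneg ?_
      rintro _ ⟨φ, hφ, hφ1, -⟩
      exact absurd ⟨φ, hφ, hφ1⟩ hne
  by_cases h0 : v = 0
  · subst h0
    by_cases hne : ∃ φ ∈ X, ‖φ‖ = 1
    · obtain ⟨φ, hφ, hφ1⟩ := hne
      have := hr φ hφ
      simp only [map_zero, zero_apply, hφ1, mul_one] at this
      simpa using mul_nonneg hm.le this
    · exfalso
      have hz : discInfSup a U X = 0 := by
        have : ∀ v₁ : V₁, {s : ℝ | ∃ φ₂ ∈ X, ‖φ₂‖ = 1 ∧ s = a v₁ φ₂} = ∅ := by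
          intro v₁
          ext s
          simp only [Set.mem_ofPred_eq, Set.mem_empty_iff_false, iff_false]
          rintro ⟨φ, hφ, hφ1, -⟩
          exact hne ⟨φ, hφ, hφ1⟩
        refine le_antisymm (Real.sInf_nonpos ?_) (Real.sInf_nonneg ?_)
        · rintro _ ⟨v₁, -, -, rfl⟩
          rw [this, Real.sSup_empty]
        · rintro _ ⟨v₁, -, -, rfl⟩
          rw [this, Real.sSup_empty]
      rw [hz] at h
      exact (one_div_pos.2 hm).ne' h
  · have hpos : 0 < ‖v‖ := norm_pos_iff.2 h0
    have hle : 1 / m ≤ sSup {s : ℝ | ∃ φ₂ ∈ X, ‖φ₂‖ = 1 ∧ s = a (‖v‖⁻¹ • v) φ₂} := by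
      rw [h]
      exact csInf_le hbdd ⟨_, U.smul_mem _ hv, norm_smul_inv_norm h0, rfl⟩
    have hne : {s : ℝ | ∃ φ₂ ∈ X, ‖φ₂‖ = 1 ∧ s = a (‖v‖⁻¹ • v) φ₂}.Nonempty := by
      by_contra hemp
      rw [Set.not_nonempty_iff_eq_empty.1 hemp, Real.sSup_empty] at hle
      exact absurd (one_div_pos.2 hm) (not_lt.2 hle)
    have hle2 : 1 / m ≤ ‖v‖⁻¹ * r := by
      refine hle.trans (csSup_le hne ?_)
      rintro _ ⟨φ, hφ, hφ1, rfl⟩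
      have := hr φ hφ
      rw [hφ1, mul_one] at this
      simpa using mul_le_mul_of_nonneg_left this (inv_nonneg.2 hpos.le)
    rw [inv_mul_eq_div, div_le_div_iff₀ hm hpos] at hle2
    linarith

/-- Stability in the second argument, by transposing the stability in the first one. -/
theorem norm_le_of_discInfSup_transpose (a : V₁ →L[ℝ] V₂ →L[ℝ] ℝ) (U : Submodule ℝ V₁)
    (X : Submodule ℝ V₂) [FiniteDimensional ℝ X] {m : ℝ} (hm : 0 < m)
    (h : 1 / m = discInfSup a U X) (hnd : ∀ v ∈ X, (∀ φ ∈ U, a φ v = 0) → v = 0) {v : V₂}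
    (hv : v ∈ X) {r : ℝ} (hr : ∀ φ ∈ U, a φ v ≤ r * ‖φ‖) (hr0 : 0 ≤ r) : ‖v‖ ≤ m * r := by
  let T : U →ₗ[ℝ] X :=
    ((InnerProductSpace.toDual ℝ X).symm.toLinearEquiv.toLinearMap).comp
      ((ContinuousLinearMap.compL ℝ X V₂ ℝ).flip X.subtypeL ∘L a ∘L U.subtypeL).toLinearMap
  have hT : ∀ (u : U) (w : X), ⟪T u, w⟫ = a u w := by
    intro u w
    change ⟪(InnerProductSpace.toDual ℝ X).symm ((a u).comp X.subtypeL), w⟫ = _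
    rw [InnerProductSpace.toDual_symm_apply]
    rfl
  have hsurj : Function.Surjective T := by
    rw [← LinearMap.range_eq_top, ← Submodule.orthogonal_eq_bot_iff, Submodule.eq_bot_iff]
    intro w hw
    refine Subtype.ext (hnd w w.2 fun φ hφ => ?_)
    rw [← hT ⟨φ, hφ⟩ w]
    exact (Submodule.mem_orthogonal _ _).1 hw _ ⟨⟨φ, hφ⟩, rfl⟩
  obtain ⟨u, hu⟩ := hsurj ⟨v, hv⟩
  have hub : ‖(u : V₁)‖ ≤ m * ‖v‖ := by
    refine norm_le_of_discInfSup a U X hm h u.2 fun φ hφ => ?_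
    rw [← hT u ⟨φ, hφ⟩, hu]
    exact real_inner_le_norm _ _
  have huv : ‖v‖ ^ 2 = a u v := by
    rw [← hT u ⟨v, hv⟩, hu]
    exact (real_inner_self_eq_norm_sq v).symm
  have h1 := hr u u.2
  rcases (norm_nonneg v).eq_or_lt with h0 | h0
  · rw [← h0]; positivity
  · refine le_of_mul_le_mul_left ?_ h0
    nlinarith [mul_le_mul_of_nonneg_left hub hr0]

theorem deltaK_nonneg (Cs : V₂ →L[ℝ] Q) (Iop : V₁ →L[ℝ] W) (P : Q → Q) (α : ℝ)
    (v w : V₁ × V₂) : 0 ≤ deltaK Cs Iop P α v w := Real.sqrt_nonneg _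

theorem deltaK_sq (Cs : V₂ →L[ℝ] Q) (Iop : V₁ →L[ℝ] W) (P : Q → Q) {α : ℝ} (hα : 0 < α)
    (v w : V₁ × V₂) : deltaK Cs Iop P α v w ^ 2 =
      α * ‖P ((-(Real.sqrt α)⁻¹) • (Cs v.2)) - P ((-(Real.sqrt α)⁻¹) • (Cs w.2))‖ ^ 2 +
        ‖Iop (v.1 - w.1)‖ ^ 2 :=
  Real.sq_sqrt (by positivity)

theorem cK_sub_cK (Cs : V₂ →L[ℝ] Q) (Iop : V₁ →L[ℝ] W) (P : Q → Q) (α : ℝ)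
    (v w φ : V₁ × V₂) : cK Cs Iop P α v φ - cK Cs Iop P α w φ =
      -⟪P ((-(Real.sqrt α)⁻¹) • (Cs v.2)) - P ((-(Real.sqrt α)⁻¹) • (Cs w.2)), Cs φ.2⟫
        - (Real.sqrt α)⁻¹ * ⟪Iop (v.1 - w.1), Iop φ.1⟫ := by
  simp only [cK, inner_sub_left, map_sub]
  ring

/-- The form `c_K` is Lipschitz with respect to the pseudometric `δ_K`. -/
theorem abs_cK_sub_cK_le (Cs : V₂ →L[ℝ] Q) (Iop : V₁ →L[ℝ] W) (P : Q → Q) {α M : ℝ}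
    (hα : 0 < α) (hC : ‖Cs‖ ≤ M) (hI : ‖Iop‖ ≤ M) (v w φ : V₁ × V₂) :
    |cK Cs Iop P α v φ - cK Cs Iop P α w φ| ≤
      M / Real.sqrt α * deltaK Cs Iop P α v w * (‖φ.1‖ + ‖φ.2‖) := by
  have hM : 0 ≤ M := (norm_nonneg _).trans hC
  have hs : 0 < Real.sqrt α := Real.sqrt_pos.2 hα
  have hss : Real.sqrt α ^ 2 = α := Real.sq_sqrt hα.le
  have hsq := deltaK_sq Cs Iop P hα v w
  have hd := deltaK_nonneg Cs Iop P α v w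
  rw [cK_sub_cK]
  set D := P ((-(Real.sqrt α)⁻¹) • (Cs v.2)) - P ((-(Real.sqrt α)⁻¹) • (Cs w.2))
  set E := Iop (v.1 - w.1)
  set δ := deltaK Cs Iop P α v w
  set s := Real.sqrt α
  have hD : s * ‖D‖ ≤ δ := abs_le_of_sq_le_sq' (by nlinarith [sq_nonneg ‖E‖]) hd |>.2
  have hE : ‖E‖ ≤ δ :=
    abs_le_of_sq_le_sq' (by nlinarith [mul_nonneg hα.le (sq_nonneg ‖D‖)]) hd |>.2
  have hD' : ‖D‖ ≤ s⁻¹ * δ := by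
    rw [inv_mul_eq_div, le_div_iff₀ hs]; linarith
  have h1 : |⟪D, Cs φ.2⟫| ≤ s⁻¹ * δ * (M * ‖φ.2‖) :=
    (abs_real_inner_le_norm _ _).trans
      (mul_le_mul hD' (Cs.le_of_opNorm_le hC _) (norm_nonneg _) (by positivity))
  have h2 : |⟪E, Iop φ.1⟫| ≤ δ * (M * ‖φ.1‖) :=
    (abs_real_inner_le_norm _ _).trans
      (mul_le_mul hE (Iop.le_of_opNorm_le hI _) (norm_nonneg _) hd)
  calc |-⟪D, Cs φ.2⟫ - s⁻¹ * ⟪E, Iop φ.1⟫|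
      ≤ |⟪D, Cs φ.2⟫| + s⁻¹ * |⟪E, Iop φ.1⟫| := by
        refine (abs_sub _ _).trans ?_
        rw [abs_neg, abs_mul, abs_of_pos (inv_pos.2 hs)]
    _ ≤ s⁻¹ * δ * (M * ‖φ.2‖) + s⁻¹ * (δ * (M * ‖φ.1‖)) := by gcongr
    _ = _ := by ring

/-- The pseudometric `δ_K` is dominated by the seminorm of the difference. -/
theorem deltaK_le_sV (Cs : V₂ →L[ℝ] Q) (Iop : V₁ →L[ℝ] W) {K : Set Q} (hK : Convex ℝ K)
    {P : Q → Q} (hPK : ∀ q, P q ∈ K) (hP : ∀ q : Q, ∀ p ∈ K, ‖q - P q‖ ≤ ‖q - p‖) {α : ℝ}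
    (hα : 0 < α) (v w : V₁ × V₂) : deltaK Cs Iop P α v w ≤ sV Cs Iop (v - w) := by
  have hs : 0 < Real.sqrt α := Real.sqrt_pos.2 hα
  have hss : Real.sqrt α ^ 2 = α := Real.sq_sqrt hα.le
  refine Real.sqrt_le_sqrt ?_
  have h := norm_sub_le_of_metric_projection hK hPK hP ((-(Real.sqrt α)⁻¹) • (Cs v.2))
    ((-(Real.sqrt α)⁻¹) • (Cs w.2))
  rw [← smul_sub, ← map_sub, norm_smul, norm_neg, norm_inv, Real.norm_of_nonneg hs.le] at h
  have h2 : Real.sqrt α * ‖P ((-(Real.sqrt α)⁻¹) • (Cs v.2)) -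
      P ((-(Real.sqrt α)⁻¹) • (Cs w.2))‖ ≤ ‖Cs (v.2 - w.2)‖ := by
    rw [inv_mul_eq_div, le_div_iff₀ hs] at h
    linarith
  have h3 := pow_le_pow_left₀ (by positivity) h2 2
  rw [mul_pow, hss] at h3
  simp only [Prod.fst_sub, Prod.snd_sub]
  linarith

/-- Monotonicity of `c_K` in the direction `(-(v₁ - w₁), v₂ - w₂)`. -/
theorem deltaK_sq_le (Cs : V₂ →L[ℝ] Q) (Iop : V₁ →L[ℝ] W) {K : Set Q} (hK : Convex ℝ K)
    {P : Q → Q} (hPK : ∀ q, P q ∈ K) (hP : ∀ q : Q, ∀ p ∈ K, ‖q - P q‖ ≤ ‖q - p‖) {α : ℝ}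
    (hα : 0 < α) (v w : V₁ × V₂) : deltaK Cs Iop P α v w ^ 2 ≤
      Real.sqrt α * (cK Cs Iop P α v (-(v.1 - w.1), v.2 - w.2) -
        cK Cs Iop P α w (-(v.1 - w.1), v.2 - w.2)) := by
  have hs : 0 < Real.sqrt α := Real.sqrt_pos.2 hα
  have hss : Real.sqrt α ^ 2 = α := Real.sq_sqrt hα.le
  have h := norm_sq_le_inner_of_metric_projection hK hPK hP ((-(Real.sqrt α)⁻¹) • (Cs v.2))
    ((-(Real.sqrt α)⁻¹) • (Cs w.2))
  rw [deltaK_sq Cs Iop P hα, cK_sub_cK]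
  rw [← smul_sub, ← map_sub, real_inner_smul_right] at h
  simp only [map_neg, inner_neg_right, real_inner_self_eq_norm_sq]
  have h2 := mul_le_mul_of_nonneg_left h hα.le
  have h3 : α * (Real.sqrt α)⁻¹ = Real.sqrt α := by
    rw [← div_eq_mul_inv, Real.div_sqrt]
  have h4 : Real.sqrt α * (Real.sqrt α)⁻¹ = 1 := mul_inv_cancel₀ hs.ne'
  calc _ ≤ α * (-(Real.sqrt α)⁻¹ * ⟪P ((-(Real.sqrt α)⁻¹) • (Cs v.2)) -
        P ((-(Real.sqrt α)⁻¹) • (Cs w.2)), Cs (v.2 - w.2)⟫) + ‖Iop (v.1 - w.1)‖ ^ 2 := by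
        linarith
    _ = -(α * (Real.sqrt α)⁻¹) * ⟪P ((-(Real.sqrt α)⁻¹) • (Cs v.2)) -
        P ((-(Real.sqrt α)⁻¹) • (Cs w.2)), Cs (v.2 - w.2)⟫ +
        (Real.sqrt α * (Real.sqrt α)⁻¹) * ‖Iop (v.1 - w.1)‖ ^ 2 := by rw [h4]; ring
    _ = _ := by rw [h3]; ring

theorem le_mul_of_sq_le {δ r A B : ℝ} (hr : 0 ≤ r) (hA : 0 ≤ A) (hB : 0 ≤ B)
    (h : δ ^ 2 ≤ A * r ^ 2 + B * r * δ) : δ ≤ (1 + A + B) * r := by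
  by_contra! hlt
  have h1 : r < δ := by nlinarith [mul_nonneg hA hr, mul_nonneg hB hr]
  have hδ : 0 < δ := hr.trans_lt h1
  nlinarith [mul_le_mul_of_nonneg_left h1.le (mul_nonneg hA hr), mul_lt_mul_of_pos_right hlt hδ,
    mul_nonneg hr hδ.le]

/-- Stability of the nonlinear discrete problem: elements of the discrete space are as close
as the residual is small. -/
theorem exists_nV_add_deltaK_le (a : V₁ →L[ℝ] V₂ →L[ℝ] ℝ) (Cs : V₂ →L[ℝ] Q)
    (Iop : V₁ →L[ℝ] W) {K : Set Q} (hK : Convex ℝ K) {P : Q → Q} (hPK : ∀ q, P q ∈ K)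
    (hP : ∀ q : Q, ∀ p ∈ K, ‖q - P q‖ ≤ ‖q - p‖) {α M m : ℝ} (hα : 0 < α) (hC : ‖Cs‖ ≤ M)
    (hI : ‖Iop‖ ≤ M) (hm : 0 ≤ m) :
    ∃ c : ℝ, 0 ≤ c ∧ ∀ (U : Submodule ℝ V₁) (X : Submodule ℝ V₂),
      (∀ v ∈ U, ∀ r : ℝ, 0 ≤ r → (∀ φ ∈ X, a v φ ≤ r * ‖φ‖) → ‖v‖ ≤ m * r) →
      (∀ v ∈ X, ∀ r : ℝ, 0 ≤ r → (∀ φ ∈ U, a φ v ≤ r * ‖φ‖) → ‖v‖ ≤ m * r) →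
      ∀ v w : V₁ × V₂, v.1 ∈ U → v.2 ∈ X → w.1 ∈ U → w.2 ∈ X → ∀ r : ℝ, 0 ≤ r →
        (∀ φ : V₁ × V₂, φ.1 ∈ U → φ.2 ∈ X →
          bK a Cs Iop P α v φ - bK a Cs Iop P α w φ ≤ r * (‖φ.1‖ + ‖φ.2‖)) →
        nV (v - w) + M / Real.sqrt α * deltaK Cs Iop P α v w ≤ c * r := by
  have hM : 0 ≤ M := (norm_nonneg _).trans hC
  have hs : 0 < Real.sqrt α := Real.sqrt_pos.2 hα
  set s := Real.sqrt α with hs_def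
  set L := M / s with hL
  have hL0 : 0 ≤ L := by positivity
  refine ⟨2 * m + (2 * m * L + L) * (1 + s * (2 * m) + s * (2 * m * L)), by positivity, ?_⟩
  intro U X hU hX v w hv1 hv2 hw1 hw2 r hr hres
  set δ := deltaK Cs Iop P α v w with hδ
  have hδ0 : 0 ≤ δ := deltaK_nonneg _ _ _ _ _ _
  have hsplit : ∀ φ : V₁ × V₂, bK a Cs Iop P α v φ - bK a Cs Iop P α w φ =
      aV a (v - w) φ + (cK Cs Iop P α v φ - cK Cs Iop P α w φ) := by
    intro φ
    simp only [bK, aV, Prod.fst_sub, Prod.snd_sub, map_sub, sub_apply]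
    ring
  have ha : ∀ φ : V₁ × V₂, φ.1 ∈ U → φ.2 ∈ X →
      aV a (v - w) φ ≤ (r + L * δ) * (‖φ.1‖ + ‖φ.2‖) := by
    intro φ h1 h2
    have h3 := hres φ h1 h2
    rw [hsplit] at h3
    have h4 := (abs_le.1 (abs_cK_sub_cK_le Cs Iop P hα hC hI v w φ)).1
    linarith
  have hrL : 0 ≤ r + L * δ := by positivity
  have he1 : ‖v.1 - w.1‖ ≤ m * (r + L * δ) := by
    refine hU _ (U.sub_mem hv1 hw1) _ hrL fun φ hφ => ?_
    simpa [aV] using ha (0, φ) U.zero_mem hφ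
  have he2 : ‖v.2 - w.2‖ ≤ m * (r + L * δ) := by
    refine hX _ (X.sub_mem hv2 hw2) _ hrL fun φ hφ => ?_
    simpa [aV] using ha (φ, 0) hφ X.zero_mem
  have hn := nV_le_add (v - w)
  simp only [Prod.fst_sub, Prod.snd_sub] at hn
  have hmon : δ ^ 2 ≤ s * (r * (‖v.1 - w.1‖ + ‖v.2 - w.2‖)) := by
    refine (deltaK_sq_le Cs Iop hK hPK hP hα v w).trans
      (mul_le_mul_of_nonneg_left ?_ hs.le)
    have h3 := hres (-(v.1 - w.1), v.2 - w.2) (U.neg_mem (U.sub_mem hv1 hw1))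
      (X.sub_mem hv2 hw2)
    rw [hsplit, norm_neg] at h3
    have h4 : aV a (v - w) (-(v.1 - w.1), v.2 - w.2) = 0 := by
      simp only [aV, Prod.fst_sub, Prod.snd_sub, map_neg, neg_apply]
      ring
    linarith
  have hδr : δ ≤ (1 + s * (2 * m) + s * (2 * m * L)) * r := by
    refine le_mul_of_sq_le hr (by positivity) (by positivity) (hmon.trans ?_)
    have := mul_le_mul_of_nonneg_left (add_le_add he1 he2) (mul_nonneg hs.le hr)
    linarith
  have := mul_le_mul_of_nonneg_left hδr (by positivity : 0 ≤ 2 * m * L + L)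
  linarith

/-- Pointwise approximability is uniform on compact sets. -/
theorem eventually_forall_mem_exists_norm_sub_lt {ι : Type*} {l : Filter ι}
    {Vh1 : ι → Submodule ℝ V₁} {Vh2 : ι → Submodule ℝ V₂}
    (happrox : ∀ v : V₁ × V₂, Tendsto (fun h => bestErr (Vh1 h) (Vh2 h) v) l (𝓝 0))
    {S : Set (V₁ × V₂)} (hS : IsCompact S) {η : ℝ} (hη : 0 < η) :
    ∀ᶠ h in l, ∀ z ∈ S, ∃ u ∈ Vh1 h, ∃ w ∈ Vh2 h, ‖z.1 - u‖ < η ∧ ‖z.2 - w‖ < η := by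
  obtain ⟨t, ht, hcov⟩ := Metric.totallyBounded_iff.1 hS.totallyBounded (η / 2) (half_pos hη)
  have hev : ∀ᶠ h in l, ∀ y ∈ t, bestErr (Vh1 h) (Vh2 h) y < η / 2 :=
    (eventually_all_finite ht).2 fun y _ => (happrox y).eventually_lt_const (half_pos hη)
  filter_upwards [hev] with h hh z hz
  obtain ⟨y, hy, hzy⟩ := Set.mem_iUnion₂.1 (hcov hz)
  have hne : {r : ℝ | ∃ vh : V₁ × V₂, vh.1 ∈ Vh1 h ∧ vh.2 ∈ Vh2 h ∧ r = nV (y - vh)}.Nonempty :=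
    ⟨_, 0, (Vh1 h).zero_mem, (Vh2 h).zero_mem, rfl⟩
  obtain ⟨_, ⟨vh, h1, h2, rfl⟩, hlt⟩ := exists_lt_of_csInf_lt hne (hh y hy)
  rw [Metric.mem_ball, dist_eq_norm] at hzy
  refine ⟨vh.1, h1, vh.2, h2, ?_, ?_⟩
  · calc ‖z.1 - vh.1‖ = ‖(z - y).1 + (y - vh).1‖ := by simp
      _ ≤ ‖(z - y).1‖ + ‖(y - vh).1‖ := norm_add_le _ _
      _ < η := by linarith [norm_fst_le (z - y), norm_fst_le_nV (y - vh)]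
  · calc ‖z.2 - vh.2‖ = ‖(z - y).2 + (y - vh).2‖ := by simp
      _ ≤ ‖(z - y).2‖ + ‖(y - vh).2‖ := norm_add_le _ _
      _ < η := by linarith [norm_snd_le (z - y), norm_snd_le_nV (y - vh)]

theorem inv_smul_mem_closedBall {E : Type*} [NormedAddCommGroup E] [NormedSpace ℝ E] {n : ℝ}
    (hn : 0 < n) {y : E} (hy : ‖y‖ ≤ n) : n⁻¹ • y ∈ Metric.closedBall (0 : E) 1 := by
  rw [mem_closedBall_zero_iff, norm_smul, norm_inv, Real.norm_of_nonneg hn.le, inv_mul_eq_div]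
  exact (div_le_one hn).2 hy

/-- Aubin–Nitsche duality: on elements that are `a`-orthogonal to the discrete spaces, the
compact seminorm is of higher order than the norm. -/
theorem eventually_sV_sq_le [CompleteSpace V₁] [CompleteSpace V₂] [CompleteSpace Q]
    [CompleteSpace W] {a : V₁ →L[ℝ] V₂ →L[ℝ] ℝ} (J : V₂ ≃ₗᵢ[ℝ] V₁)
    (hJ : ∀ v₁ v₂, a v₁ v₂ = ⟪v₁, J v₂⟫) {Cs : V₂ →L[ℝ] Q} {Iop : V₁ →L[ℝ] W}
    (hIc : IsCompactOperator (⇑Iop)) (hCc : IsCompactOperator (⇑Cs)) {ι : Type*}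
    {l : Filter ι} {Vh1 : ι → Submodule ℝ V₁} {Vh2 : ι → Submodule ℝ V₂}
    (happrox : ∀ v : V₁ × V₂, Tendsto (fun h => bestErr (Vh1 h) (Vh2 h) v) l (𝓝 0))
    {η : ℝ} (hη : 0 < η) :
    ∀ᶠ h in l, ∀ e : V₁ × V₂, (∀ φ ∈ Vh2 h, a e.1 φ = 0) → (∀ φ ∈ Vh1 h, a φ e.2 = 0) →
      sV Cs Iop e ^ 2 ≤ 2 * η * nV e ^ 2 := by
  have hIK := hIc.isCompact_closure_image_closedBall (f := (Iop : V₁ →ₗ[ℝ] W)) 1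
  have hCK := hCc.isCompact_closure_image_closedBall (f := (Cs : V₂ →ₗ[ℝ] Q)) 1
  let F : W × Q → V₁ × V₂ := fun p =>
    (J (ContinuousLinearMap.adjoint Cs p.2), J.symm (ContinuousLinearMap.adjoint Iop p.1))
  have hF : Continuous F := by fun_prop
  filter_upwards [eventually_forall_mem_exists_norm_sub_lt happrox
    ((hIK.prod hCK).image hF) hη] with h hh e he1 he2
  have hn0 := nV_nonneg e
  rcases hn0.eq_or_lt with h0 | hn
  · have h1 : e.1 = 0 := norm_le_zero_iff.1 (h0 ▸ norm_fst_le_nV e)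
    have h2 : e.2 = 0 := norm_le_zero_iff.1 (h0 ▸ norm_snd_le_nV e)
    simp [sV, nV, h1, h2]
  set n := nV e
  obtain ⟨u, hu, w, hw, hzu, hzw⟩ := hh (F (Iop (n⁻¹ • e.1), Cs (n⁻¹ • e.2)))
    ⟨_, ⟨subset_closure ⟨_, inv_smul_mem_closedBall hn (norm_fst_le_nV e), rfl⟩,
      subset_closure ⟨_, inv_smul_mem_closedBall hn (norm_snd_le_nV e), rfl⟩⟩, rfl⟩
  have hI : ‖Iop e.1‖ ^ 2 ≤ η * n ^ 2 := by
    have h1 : ‖Iop e.1‖ ^ 2 = n * ⟪e.1, J ((F (Iop (n⁻¹ • e.1), Cs (n⁻¹ • e.2))).2 - w)⟫ := by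
      have h2 := he1 w hw
      rw [hJ] at h2
      rw [map_sub, inner_sub_right, h2]
      simp only [F, LinearIsometryEquiv.apply_symm_apply,
        ContinuousLinearMap.adjoint_inner_right, map_smul, real_inner_smul_right,
        real_inner_self_eq_norm_sq]
      field_simp
      ring
    have h3 := real_inner_le_norm e.1 (J ((F (Iop (n⁻¹ • e.1), Cs (n⁻¹ • e.2))).2 - w))
    rw [J.norm_map] at h3
    have h4 := mul_le_mul (norm_fst_le_nV e) hzw.le (norm_nonneg _) hn0
    have h5 := mul_le_mul_of_nonneg_left (h3.trans h4) hn0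
    rw [h1]
    linarith
  have hC : ‖Cs e.2‖ ^ 2 ≤ η * n ^ 2 := by
    have h1 : ‖Cs e.2‖ ^ 2 = n * ⟪(F (Iop (n⁻¹ • e.1), Cs (n⁻¹ • e.2))).1 - u, J e.2⟫ := by
      have h2 := he2 u hu
      rw [hJ] at h2
      rw [inner_sub_left, h2]
      simp only [F, LinearIsometryEquiv.inner_map_map,
        ContinuousLinearMap.adjoint_inner_left, map_smul, real_inner_smul_left,
        real_inner_self_eq_norm_sq]
      field_simp
      ring
    have h3 := real_inner_le_norm ((F (Iop (n⁻¹ • e.1), Cs (n⁻¹ • e.2))).1 - u) (J e.2)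
    rw [J.norm_map] at h3
    have h4 := mul_le_mul hzu.le (norm_snd_le_nV e) (norm_nonneg _) hη.le
    have h5 := mul_le_mul_of_nonneg_left (h3.trans h4) hn0
    rw [h1]
    linarith
  rw [sV, Real.sq_sqrt (by positivity)]
  linarith

end Helpers

/-- Theorem 5.6, supercloseness to the generalized Ritz
approximation: under compactness, uniform stability and approximability,
`d_{K,α}(x_h, R_h x) ≤ (M/√α) κ̄ μ̄ o(‖x − R_h x‖)` as `h → 0`. -/
theorem stmt18
    {V₁ V₂ Q W : Type*}
    [NormedAddCommGroup V₁] [InnerProductSpace ℝ V₁] [CompleteSpace V₁] [Nontrivial V₁]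
    [NormedAddCommGroup V₂] [InnerProductSpace ℝ V₂] [CompleteSpace V₂] [Nontrivial V₂]
    [NormedAddCommGroup Q] [InnerProductSpace ℝ Q] [CompleteSpace Q]
    [NormedAddCommGroup W] [InnerProductSpace ℝ W] [CompleteSpace W]
    (a : V₁ →L[ℝ] V₂ →L[ℝ] ℝ) (Cs : V₂ →L[ℝ] Q) (Iop : V₁ →L[ℝ] W)
    (α m_a M_C M_I M L : ℝ) (hα : 0 < α)
    (hma : m_a = infSupConst a) (hma_pos : 0 < m_a)
    (hnd : ∀ v₁ : V₁, (∀ v₂ : V₂, a v₁ v₂ = 0) → v₁ = 0)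
    (hadj : ∀ v₂ : V₂, ‖v₂‖ = sSup {r : ℝ | ∃ φ₁ : V₁, ‖φ₁‖ = 1 ∧ r = a φ₁ v₂})
    (hMC : M_C = ‖Cs‖) (hMI : M_I = ‖Iop‖) (hM : M = max M_I M_C)
    (hL : L = M / Real.sqrt α)
    -- compactness of the observation and control-action operators
    (hIc : IsCompactOperator (⇑Iop)) (hCc : IsCompactOperator (⇑Cs))
    (K : Set Q) (hK_ne : K.Nonempty) (hK_cl : IsClosed K) (hK_cx : Convex ℝ K)
    (PK : Q → Q) (hPK_mem : ∀ q, PK q ∈ K)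
    (hPK : ∀ q : Q, ∀ p ∈ K, ‖q - PK q‖ ≤ ‖q - p‖)
    -- family of discretizations
    (Vh1 : ℝ → Submodule ℝ V₁) (Vh2 : ℝ → Submodule ℝ V₂)
    (hfd1 : ∀ h > (0 : ℝ), FiniteDimensional ℝ (Vh1 h))
    (hfd2 : ∀ h > (0 : ℝ), FiniteDimensional ℝ (Vh2 h))
    (hndh1 : ∀ h > (0 : ℝ), ∀ v₁ ∈ Vh1 h, (∀ φ₂ ∈ Vh2 h, a v₁ φ₂ = 0) → v₁ = 0)
    (hndh2 : ∀ h > (0 : ℝ), ∀ v₂ ∈ Vh2 h, (∀ φ₁ ∈ Vh1 h, a φ₁ v₂ = 0) → v₂ = 0)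
    (μ : ℝ → ℝ) (μbar κbar : ℝ)
    (hμ_pos : ∀ h > (0 : ℝ), 0 < μ h)
    (hμ : ∀ h > (0 : ℝ), 1 / μ h = discInfSup a (Vh1 h) (Vh2 h))
    (hstab : ∀ h > (0 : ℝ), μ h ≤ μbar)
    (hκbar : κbar = ((1 + 2 * L) / (1 + L)) * (1 + M * (1 + 2 * M / Real.sqrt α) * μbar))
    (happrox : ∀ v : V₁ × V₂,
      Tendsto (fun h => bestErr (Vh1 h) (Vh2 h) v) (𝓝[>] (0 : ℝ)) (𝓝 0))
    -- exact solution, discrete solutions and generalized Ritz projections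
    (u_d : W) (x : V₁ × V₂) (xh : ℝ → V₁ × V₂) (Rh : ℝ → (V₁ × V₂) → V₁ × V₂)
    (hx : ∀ φ : V₁ × V₂, bK a Cs Iop PK α x φ = -(Real.sqrt α)⁻¹ * ⟪u_d, Iop φ.1⟫)
    (hxh_mem : ∀ h > (0 : ℝ), (xh h).1 ∈ Vh1 h ∧ (xh h).2 ∈ Vh2 h)
    (hxh : ∀ h > (0 : ℝ), ∀ φh : V₁ × V₂, φh.1 ∈ Vh1 h → φh.2 ∈ Vh2 h →
      bK a Cs Iop PK α (xh h) φh = -(Real.sqrt α)⁻¹ * ⟪u_d, Iop φh.1⟫)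
    (hRh_mem : ∀ h > (0 : ℝ), ∀ v : V₁ × V₂, (Rh h v).1 ∈ Vh1 h ∧ (Rh h v).2 ∈ Vh2 h)
    (hRh1 : ∀ h > (0 : ℝ), ∀ v : V₁ × V₂, ∀ φ₂ ∈ Vh2 h, a (Rh h v).1 φ₂ = a v.1 φ₂)
    (hRh2 : ∀ h > (0 : ℝ), ∀ v : V₁ × V₂, ∀ φ₁ ∈ Vh1 h, a φ₁ (Rh h v).2 = a φ₁ v.2) :
    ∃ ε : ℝ → ℝ, (∀ h, 0 ≤ ε h) ∧ Tendsto ε (𝓝[>] (0 : ℝ)) (𝓝 0) ∧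
      ∀ h > (0 : ℝ),
        nV (xh h - Rh h x) + (M / Real.sqrt α) * deltaK Cs Iop PK α (xh h) (Rh h x) ≤
          (M / Real.sqrt α) * κbar * μbar * ε h * nV (x - Rh h x) := by
  have hs : 0 < Real.sqrt α := Real.sqrt_pos.2 hα
  have hC : ‖Cs‖ ≤ M := by rw [hM, hMC]; exact le_max_right _ _
  have hI : ‖Iop‖ ≤ M := by rw [hM, hMI]; exact le_max_left _ _
  have hM0 : 0 ≤ M := (norm_nonneg _).trans hC
  have hμbar : 0 < μbar := (hμ_pos 1 one_pos).trans_le (hstab 1 one_pos)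
  have hL0 : 0 ≤ L := by rw [hL]; positivity
  have hκ : 0 < κbar := by rw [hκbar]; positivity
  obtain ⟨J, hJ⟩ := exists_linearIsometryEquiv_of_adjoint_norm a hnd hadj
  obtain ⟨c, hc, hstable⟩ :=
    exists_nV_add_deltaK_le a Cs Iop hK_cx hPK_mem hPK hα hC hI hμbar.le
  have horth1 : ∀ h > (0 : ℝ), ∀ φ ∈ Vh2 h, a (x - Rh h x).1 φ = 0 := by
    intro h hh φ hφ
    simp [hRh1 h hh x φ hφ]
  have horth2 : ∀ h > (0 : ℝ), ∀ φ ∈ Vh1 h, a φ (x - Rh h x).2 = 0 := by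
    intro h hh φ hφ
    simp [hRh2 h hh x φ hφ]
  have hmain : ∀ h > (0 : ℝ),
      nV (xh h - Rh h x) + (M / Real.sqrt α) * deltaK Cs Iop PK α (xh h) (Rh h x) ≤
        c * (M / Real.sqrt α * sV Cs Iop (x - Rh h x)) := by
    intro h hh
    have := hfd2 h hh
    refine hstable (Vh1 h) (Vh2 h) ?_ ?_ _ _ (hxh_mem h hh).1 (hxh_mem h hh).2
      (hRh_mem h hh x).1 (hRh_mem h hh x).2 _
      (mul_nonneg (by positivity) (Real.sqrt_nonneg _)) ?_
    · intro v hv r hr hvr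
      exact (norm_le_of_discInfSup a _ _ (hμ_pos h hh) (hμ h hh) hv hvr).trans
        (mul_le_mul_of_nonneg_right (hstab h hh) hr)
    · intro v hv r hr hvr
      exact (norm_le_of_discInfSup_transpose a _ _ (hμ_pos h hh) (hμ h hh) (hndh2 h hh) hv
        hvr hr).trans (mul_le_mul_of_nonneg_right (hstab h hh) hr)
    · intro φ h1 h2
      have h3 : bK a Cs Iop PK α (xh h) φ - bK a Cs Iop PK α (Rh h x) φ =
          cK Cs Iop PK α x φ - cK Cs Iop PK α (Rh h x) φ := by
        rw [hxh h hh φ h1 h2, ← hx φ]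
        simp only [bK, aV]
        rw [hRh1 h hh x _ h2, hRh2 h hh x _ h1]
        ring
      rw [h3]
      refine (le_abs_self _).trans ((abs_cK_sub_cK_le Cs Iop PK hα hC hI _ _ _).trans ?_)
      gcongr
      exact deltaK_le_sV Cs Iop hK_cx hPK_mem hPK hα _ _
  have hnum : ∀ h, 0 ≤ nV (xh h - Rh h x) +
      (M / Real.sqrt α) * deltaK Cs Iop PK α (xh h) (Rh h x) := fun h =>
    add_nonneg (nV_nonneg _) (mul_nonneg (by positivity) (deltaK_nonneg _ _ _ _ _ _))
  have hden : ∀ h, 0 ≤ (M / Real.sqrt α) * κbar * μbar * nV (x - Rh h x) := fun h =>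
    mul_nonneg (by positivity) (nV_nonneg _)
  refine ⟨fun h => (nV (xh h - Rh h x) +
      (M / Real.sqrt α) * deltaK Cs Iop PK α (xh h) (Rh h x)) /
      ((M / Real.sqrt α) * κbar * μbar * nV (x - Rh h x)),
    fun h => div_nonneg (hnum h) (hden h), ?_, ?_⟩
  · rw [Metric.tendsto_nhds]
    intro η hη
    set θ := η * (κbar * μbar) / (c + 1) with hθ
    have hθ0 : 0 < θ := by positivity
    filter_upwards [eventually_sV_sq_le J hJ hIc hCc happrox
      (by positivity : 0 < θ ^ 2 / 8), self_mem_nhdsWithin] with h hh hpos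
    rw [dist_zero_right, Real.norm_of_nonneg (div_nonneg (hnum h) (hden h))]
    rcases (hden h).eq_or_lt with h0 | h0
    · rw [← h0, div_zero]; exact hη
    rw [div_lt_iff₀ h0]
    have hn0 := nV_nonneg (x - Rh h x)
    have hsq := hh _ (horth1 h hpos) (horth2 h hpos)
    have hsV : sV Cs Iop (x - Rh h x) ≤ θ / 2 * nV (x - Rh h x) :=
      abs_le_of_sq_le_sq' (by linarith) (by positivity) |>.2
    have hLn : 0 < M / Real.sqrt α * nV (x - Rh h x) := by
      refine pos_of_mul_pos_left (b := κbar * μbar) ?_ (by positivity)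
      linarith
    calc _ ≤ c * (M / Real.sqrt α * sV Cs Iop (x - Rh h x)) := hmain h hpos
      _ ≤ c * (M / Real.sqrt α * (θ / 2 * nV (x - Rh h x))) := by gcongr
      _ = (c * (θ / 2)) * (M / Real.sqrt α * nV (x - Rh h x)) := by ring
      _ < (η * (κbar * μbar)) * (M / Real.sqrt α * nV (x - Rh h x)) := by
        refine mul_lt_mul_of_pos_right ?_ hLn
        have : θ * (c + 1) = η * (κbar * μbar) := by rw [hθ]; field_simp
        nlinarith
      _ = _ := by ring
  · intro h hh
    rcases (hden h).eq_or_lt with h0 | h0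
    · have hz : M / Real.sqrt α * sV Cs Iop (x - Rh h x) = 0 := by
        have h1 : M / Real.sqrt α * nV (x - Rh h x) = 0 := by
          have : (M / Real.sqrt α * nV (x - Rh h x)) * (κbar * μbar) = 0 := by linarith
          exact (mul_eq_zero.1 this).resolve_right (by positivity)
        rcases mul_eq_zero.1 h1 with h2 | h2
        · rw [h2, zero_mul]
        · have h3 : (x - Rh h x).1 = 0 := norm_le_zero_iff.1 (h2 ▸ norm_fst_le_nV _)
          have h4 : (x - Rh h x).2 = 0 := norm_le_zero_iff.1 (h2 ▸ norm_snd_le_nV _)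
          simp [sV, h3, h4]
      have h5 := hmain h hh
      rw [hz, mul_zero] at h5
      refine h5.trans ?_
      have := mul_nonneg (div_nonneg (hnum h) (hden h)) (hden h)
      linarith
    · have := div_mul_cancel₀ (nV (xh h - Rh h x) +
        (M / Real.sqrt α) * deltaK Cs Iop PK α (xh h) (Rh h x)) h0.ne'
      linarith
end
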